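/- arXiv:2508.02357 — 3 statements merged into one kernel-verified Lean document; each statement's English description precedes it below -/
import Mathlib

section
/- Assume the data-consistency hypothesis: there exist a matrix A ∈ ℝ^{m×m}, a column vector a ∈ ℝ^m and a noise matrix Ψ ∈ ℝ^{m×T} such that O1+ = A·O1 + a·O2 + Ψ and Ψ·Ψᵀ ⪯ γ·γᵀ. Suppose κ1 > 0, κ2 ≥ 0, a symmetric positive definite Q ∈ ℝ^{m×m} and a row vector K ∈ ℝ^{1×m} satisfy the SDP (10). Set P = Q⁻¹ and M = A + a·(K·P) ∈ ℝ^{m×m}. Then: (i) P·M + Mᵀ·P ⪯ −κ1·P·P; (ii) every differentiable function x : ℝ → ℝ^m satisfying ẋ(t) = M·x(t) for all t ≥ 0 satisfies both d/dt (x(t)ᵀ·P·x(t)) ≤ −κ1·‖P·x(t)‖² for all t ≥ 0 and x(t) → 0 as t → +∞. -/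
open Matrix Filter

/-- A real quadratic form is bounded by a positive multiple of the squared Euclidean norm. -/
theorem Matrix.exists_pos_dotProduct_mulVec_le {n : Type*} [Fintype n] (Q : Matrix n n ℝ) :
    ∃ C : ℝ, 0 < C ∧ ∀ y : n → ℝ, y ⬝ᵥ Q *ᵥ y ≤ C * (y ⬝ᵥ y) := by
  refine ⟨1 + ∑ i, ∑ j, |Q i j|, by positivity, fun y => ?_⟩
  have hsq : ∀ i, y i ^ 2 ≤ y ⬝ᵥ y := fun i => by
    rw [pow_two]
    exact Finset.single_le_sum (f := fun i => y i * y i) (fun j _ => mul_self_nonneg _)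
      (Finset.mem_univ i)
  have hterm : ∀ i j, y i * (Q i j * y j) ≤ |Q i j| * (y ⬝ᵥ y) := fun i j => by
    have hij : |y i * y j| ≤ y ⬝ᵥ y := by
      rw [abs_le]
      constructor <;> nlinarith [hsq i, hsq j, sq_nonneg (y i + y j), sq_nonneg (y i - y j)]
    calc y i * (Q i j * y j) = Q i j * (y i * y j) := by ring
      _ ≤ |Q i j| * |y i * y j| := by rw [← abs_mul]; exact le_abs_self _
      _ ≤ |Q i j| * (y ⬝ᵥ y) := by gcongr
  have hy : 0 ≤ y ⬝ᵥ y := Finset.sum_nonneg fun i _ => mul_self_nonneg (y i)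
  calc y ⬝ᵥ Q *ᵥ y = ∑ i, ∑ j, y i * (Q i j * y j) := by
        simp only [dotProduct, mulVec, Finset.mul_sum]
    _ ≤ ∑ i, ∑ j, |Q i j| * (y ⬝ᵥ y) :=
        Finset.sum_le_sum fun i _ => Finset.sum_le_sum fun j _ => hterm i j
    _ = (∑ i, ∑ j, |Q i j|) * (y ⬝ᵥ y) := by simp only [Finset.sum_mul]
    _ ≤ (1 + ∑ i, ∑ j, |Q i j|) * (y ⬝ᵥ y) := by nlinarith

/-- An upper bound `Q ⪯ C` of a positive definite form gives the lower bound `C⁻¹ ⪯ Q⁻¹`. -/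
theorem Matrix.PosDef.dotProduct_self_le_mul_inv {n : Type*} [Fintype n] [DecidableEq n]
    {Q : Matrix n n ℝ} (hQ : Q.PosDef) {C : ℝ} (hC : 0 < C)
    (h : ∀ y : n → ℝ, y ⬝ᵥ Q *ᵥ y ≤ C * (y ⬝ᵥ y)) (x : n → ℝ) :
    x ⬝ᵥ x ≤ C * (x ⬝ᵥ Q⁻¹ *ᵥ x) := by
  have hdet : IsUnit Q.det := hQ.det_pos.ne'.isUnit
  have hQx : Q *ᵥ (Q⁻¹ *ᵥ x) = x := by
    rw [mulVec_mulVec, mul_nonsing_inv _ hdet, one_mulVec]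
  have hsymm : Qᵀ = Q := by simpa using hQ.isHermitian.eq
  have hcross : (Q⁻¹ *ᵥ x) ⬝ᵥ Q *ᵥ x = x ⬝ᵥ x := by
    rw [dotProduct_mulVec, ← mulVec_transpose, hsymm, hQx]
  have hpos := hQ.posSemidef.dotProduct_mulVec_nonneg (Q⁻¹ *ᵥ x - C⁻¹ • x)
  simp only [star_trivial, mulVec_sub, mulVec_smul, sub_dotProduct, dotProduct_sub,
    smul_dotProduct, dotProduct_smul, smul_eq_mul, hQx, hcross,
    dotProduct_comm (Q⁻¹ *ᵥ x) x] at hpos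
  have hx := mul_le_mul_of_nonneg_left (h x) (by positivity : 0 ≤ C⁻¹ * C⁻¹)
  have hx' : C⁻¹ * C⁻¹ * (C * (x ⬝ᵥ x)) = C⁻¹ * (x ⬝ᵥ x) := by field_simp
  have hle : C⁻¹ * (x ⬝ᵥ x) ≤ x ⬝ᵥ Q⁻¹ *ᵥ x := by nlinarith
  calc x ⬝ᵥ x = C * (C⁻¹ * (x ⬝ᵥ x)) := by field_simp
    _ ≤ C * (x ⬝ᵥ Q⁻¹ *ᵥ x) := by gcongr

theorem HasDerivAt.dotProduct {n : Type*} [Fintype n] {x y : ℝ → n → ℝ} {x' y' : n → ℝ} {t : ℝ}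
    (hx : HasDerivAt x x' t) (hy : HasDerivAt y y' t) :
    HasDerivAt (fun s => x s ⬝ᵥ y s) (x' ⬝ᵥ y t + x t ⬝ᵥ y') t := by
  have h := HasDerivAt.fun_sum (u := Finset.univ) fun i _ =>
    (hasDerivAt_pi.1 hx i).mul (hasDerivAt_pi.1 hy i)
  rw [Finset.sum_add_distrib] at h
  exact h

theorem HasDerivAt.matrix_mulVec {n k : Type*} [Fintype n] [Fintype k] (P : Matrix k n ℝ)
    {x : ℝ → n → ℝ} {x' : n → ℝ} {t : ℝ} (hx : HasDerivAt x x' t) :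
    HasDerivAt (fun s => P *ᵥ x s) (P *ᵥ x') t :=
  hasDerivAt_pi.2 fun i => by
    have h := (hasDerivAt_const t (P i)).dotProduct hx
    rw [zero_dotProduct, zero_add] at h
    exact h

/-- A nonnegative function with `V' ≤ -c V` on `[0, ∞)`, `c > 0`, tends to zero. -/
theorem tendsto_zero_of_hasDerivAt_le_neg_mul {V V' : ℝ → ℝ} {c : ℝ} (hc : 0 < c)
    (hV : ∀ t, 0 ≤ t → HasDerivAt V (V' t) t) (hle : ∀ t, 0 ≤ t → V' t ≤ -c * V t)
    (hnonneg : ∀ t, 0 ≤ V t) : Tendsto V atTop (nhds 0) := by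
  have hder : ∀ t, 0 ≤ t → HasDerivAt (fun s => Real.exp (c * s) * V s)
      (Real.exp (c * t) * c * V t + Real.exp (c * t) * V' t) t := fun t ht => by
    have hexp : HasDerivAt (fun s => Real.exp (c * s)) (Real.exp (c * t) * c) t := by
      simpa using ((hasDerivAt_id t).const_mul c).exp
    exact hexp.mul (hV t ht)
  have hanti : AntitoneOn (fun s => Real.exp (c * s) * V s) (Set.Ici 0) := by
    refine antitoneOn_of_deriv_nonpos (convex_Ici 0)
      (fun t ht => (hder t ht).continuousAt.continuousWithinAt)
      (fun t ht => (hder t (interior_subset ht)).differentiableAt.differentiableWithinAt)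
      fun t ht => ?_
    rw [(hder t (interior_subset ht)).deriv]
    nlinarith [Real.exp_pos (c * t), hle t (interior_subset ht)]
  have hbound : ∀ t, 0 ≤ t → V t ≤ V 0 * Real.exp (-(c * t)) := fun t ht => by
    have h := hanti (Set.mem_Ici.2 le_rfl) (Set.mem_Ici.2 ht) ht
    simp only [mul_zero, Real.exp_zero, one_mul] at h
    rw [Real.exp_neg, ← div_eq_mul_inv, le_div_iff₀ (Real.exp_pos _)]
    linarith
  have hlim : Tendsto (fun t => V 0 * Real.exp (-(c * t))) atTop (nhds 0) := by
    simpa using (Real.tendsto_exp_neg_atTop_nhds_zero.comp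
      (tendsto_id.const_mul_atTop hc)).const_mul (V 0)
  exact squeeze_zero' (Eventually.of_forall hnonneg)
    ((eventually_ge_atTop 0).mono hbound) hlim

theorem tendsto_zero_of_dotProduct_self {n α : Type*} [Fintype n] {l : Filter α} {x : α → n → ℝ}
    (h : Tendsto (fun t => x t ⬝ᵥ x t) l (nhds 0)) : Tendsto x l (nhds 0) := by
  refine tendsto_pi_nhds.2 fun i => ?_
  have hsq : Tendsto (fun t => x t i * x t i) l (nhds 0) :=
    squeeze_zero (fun t => mul_self_nonneg _)
      (fun t => Finset.single_le_sum (f := fun i => x t i * x t i)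
        (fun j _ => mul_self_nonneg _) (Finset.mem_univ i)) h
  have habs : Tendsto (fun t => |x t i|) l (nhds 0) := by
    simpa only [Function.comp_def, Real.sqrt_mul_self_eq_abs, Real.sqrt_zero] using
      (Real.continuous_sqrt.tendsto 0).comp hsq
  exact (tendsto_zero_iff_abs_tendsto_zero _).2 habs

/-- Compressing a block quadratic matrix inequality by `[1 W]`. -/
theorem Matrix.PosSemidef.compress_fromBlocks {n k : Type*} [Fintype n] [Fintype k]
    [DecidableEq n] {B₁₁ : Matrix n n ℝ} {B₁₂ : Matrix n k ℝ} {B₂₁ : Matrix k n ℝ}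
    {B₂₂ : Matrix k k ℝ} (h : (-(fromBlocks B₁₁ B₁₂ B₂₁ B₂₂)).PosSemidef) (W : Matrix n k ℝ) :
    (-(B₁₁ + W * B₂₁ + B₁₂ * Wᵀ + W * B₂₂ * Wᵀ)).PosSemidef := by
  have h' := h.mul_mul_conjTranspose_same (fromCols (1 : Matrix n n ℝ) W)
  convert h' using 1
  rw [conjTranspose_eq_transpose_of_trivial, transpose_fromCols, Matrix.mul_neg, Matrix.neg_mul,
    fromCols_mul_fromBlocks, fromCols_mul_fromRows]
  simp only [transpose_one, Matrix.one_mul, Matrix.mul_one, Matrix.add_mul]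
  abel

/-- Theorem 1: feasibility of the data-dependent SDP (10) yields a virtual
controller `φ(x_r) = K P x_r` (with `P = Q⁻¹`) such that `M = A + a (K P)`
satisfies the Lyapunov inequality `P M + Mᵀ P ⪯ -κ1 P P`, hence the Lyapunov
function `V(x) = xᵀ P x` decreases along trajectories of `ẋ = M x`, which
converge to the origin. -/
theorem data_driven_virtual_controller (m T : ℕ) (hm : 1 ≤ m) (hT : 1 ≤ T)
    (O1 O1p γ : Matrix (Fin m) (Fin T) ℝ)
    (O2 : Matrix (Fin 1) (Fin T) ℝ)
    -- data-consistency: there exist `A`, `a`, `Ψ` with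
    -- `O1+ = A O1 + a O2 + Ψ` and `Ψ Ψᵀ ⪯ γ γᵀ`
    (A : Matrix (Fin m) (Fin m) ℝ) (a : Matrix (Fin m) (Fin 1) ℝ)
    (Ψ : Matrix (Fin m) (Fin T) ℝ)
    (hdata : O1p = A * O1 + a * O2 + Ψ)
    (hnoise : (γ * γᵀ - Ψ * Ψᵀ).PosSemidef)
    (κ1 κ2 : ℝ) (hκ1 : 0 < κ1) (hκ2 : 0 ≤ κ2)
    (Q : Matrix (Fin m) (Fin m) ℝ) (hQsymm : Q.IsSymm) (hQ : Q.PosDef)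
    (K : Matrix (Fin 1) (Fin m) ℝ)
    -- the SDP (10): the indicated symmetric block matrix is negative semidefinite
    (hSDP :
      (-(Matrix.fromBlocks
          (κ1 • (1 : Matrix (Fin m) (Fin m) ℝ) - κ2 • (O1p * O1pᵀ - γ * γᵀ))
          ((Matrix.fromRows K Q)ᵀ + κ2 • (O1p * (Matrix.fromRows O2 O1)ᵀ))
          (Matrix.fromRows K Q + κ2 • (Matrix.fromRows O2 O1 * O1pᵀ))
          (-(κ2 • (Matrix.fromRows O2 O1 * (Matrix.fromRows O2 O1)ᵀ))))).PosSemidef) :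
    -- (i) `P M + Mᵀ P ⪯ -κ1 P P` with `P = Q⁻¹` and `M = A + a (K P)`
    ((-(κ1 • (Q⁻¹ * Q⁻¹)))
        - (Q⁻¹ * (A + a * (K * Q⁻¹)) + (A + a * (K * Q⁻¹))ᵀ * Q⁻¹)).PosSemidef ∧
      -- (ii) every differentiable solution of `ẋ = M x` on `t ≥ 0` satisfies the
      -- Lyapunov decrease and converges to the origin
      ∀ x : ℝ → Fin m → ℝ, Differentiable ℝ x →
        (∀ t : ℝ, 0 ≤ t → HasDerivAt x ((A + a * (K * Q⁻¹)).mulVec (x t)) t) →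
        (∀ t : ℝ, 0 ≤ t →
            deriv (fun s => x s ⬝ᵥ (Q⁻¹).mulVec (x s)) t
              ≤ -κ1 * ((Q⁻¹.mulVec (x t)) ⬝ᵥ (Q⁻¹.mulVec (x t)))) ∧
          Tendsto x atTop (nhds 0) := by
  have hdet : IsUnit Q.det := hQ.det_pos.ne'.isUnit
  have hPsymm : (Q⁻¹)ᵀ = Q⁻¹ := by rw [transpose_nonsing_inv, hQsymm.eq]
  set M := A + a * (K * Q⁻¹) with hM
  have hMQ : M * Q = A * Q + a * K := by
    rw [hM, Matrix.add_mul, Matrix.mul_assoc, Matrix.mul_assoc, nonsing_inv_mul _ hdet,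
      Matrix.mul_one]
  have hLyapQ : (-(κ1 • (1 : Matrix (Fin m) (Fin m) ℝ)) - (M * Q + Q * Mᵀ)).PosSemidef := by
    have h := (hSDP.compress_fromBlocks (fromCols a A)).add (hnoise.smul hκ2)
    convert h using 1
    have hN : fromCols a A * fromRows K Q = M * Q := by
      rw [fromCols_mul_fromRows, hMQ, add_comm]
    have hNt : (fromRows K Q)ᵀ * (fromCols a A)ᵀ = Q * Mᵀ := by
      rw [← transpose_mul, hN, transpose_mul, hQsymm.eq]
    have hG : fromCols a A * fromRows O2 O1 = O1p - Ψ := by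
      rw [fromCols_mul_fromRows, hdata]; abel
    have hGt : (fromRows O2 O1)ᵀ * (fromCols a A)ᵀ = O1pᵀ - Ψᵀ := by
      rw [← transpose_mul, hG, transpose_sub]
    have h1 : fromCols a A * (fromRows K Q + κ2 • (fromRows O2 O1 * O1pᵀ))
        = M * Q + κ2 • ((O1p - Ψ) * O1pᵀ) := by
      rw [Matrix.mul_add, hN, Matrix.mul_smul, ← Matrix.mul_assoc, hG]
    have h2 : ((fromRows K Q)ᵀ + κ2 • (O1p * (fromRows O2 O1)ᵀ)) * (fromCols a A)ᵀ
        = Q * Mᵀ + κ2 • (O1p * (O1pᵀ - Ψᵀ)) := by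
      rw [Matrix.add_mul, hNt, Matrix.smul_mul, Matrix.mul_assoc, hGt]
    have h3 : fromCols a A * -(κ2 • (fromRows O2 O1 * (fromRows O2 O1)ᵀ)) * (fromCols a A)ᵀ
        = -(κ2 • ((O1p - Ψ) * (O1pᵀ - Ψᵀ))) := by
      rw [Matrix.mul_neg, Matrix.neg_mul, Matrix.mul_smul, Matrix.smul_mul, ← Matrix.mul_assoc,
        hG, Matrix.mul_assoc, hGt]
    rw [h1, h2, h3]
    simp only [Matrix.sub_mul, Matrix.mul_sub]
    module
  have hLyap : (-(κ1 • (Q⁻¹ * Q⁻¹)) - (Q⁻¹ * M + Mᵀ * Q⁻¹)).PosSemidef := by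
    have h := hLyapQ.mul_mul_conjTranspose_same Q⁻¹
    convert h using 1
    rw [conjTranspose_eq_transpose_of_trivial, hPsymm]
    have h1 : Q⁻¹ * (M * Q) * Q⁻¹ = Q⁻¹ * M := by
      rw [← Matrix.mul_assoc, Matrix.mul_assoc, mul_nonsing_inv _ hdet, Matrix.mul_one]
    have h2 : Q⁻¹ * (Q * Mᵀ) * Q⁻¹ = Mᵀ * Q⁻¹ := by
      rw [← Matrix.mul_assoc, nonsing_inv_mul _ hdet, Matrix.one_mul]
    simp only [Matrix.mul_sub, Matrix.sub_mul, Matrix.mul_add, Matrix.add_mul, h1, h2,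
      Matrix.mul_neg, Matrix.neg_mul, Matrix.mul_smul, Matrix.smul_mul, Matrix.mul_one]
  refine ⟨hLyap, fun x _ hx => ?_⟩
  have hV : ∀ t, 0 ≤ t → HasDerivAt (fun s => x s ⬝ᵥ Q⁻¹ *ᵥ x s)
      ((M *ᵥ x t) ⬝ᵥ Q⁻¹ *ᵥ x t + x t ⬝ᵥ Q⁻¹ *ᵥ (M *ᵥ x t)) t :=
    fun t ht => (hx t ht).dotProduct ((hx t ht).matrix_mulVec Q⁻¹)
  have hdecr : ∀ t, (M *ᵥ x t) ⬝ᵥ Q⁻¹ *ᵥ x t + x t ⬝ᵥ Q⁻¹ *ᵥ (M *ᵥ x t)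
      ≤ -κ1 * ((Q⁻¹ *ᵥ x t) ⬝ᵥ Q⁻¹ *ᵥ x t) := fun t => by
    have h := hLyap.dotProduct_mulVec_nonneg (x t)
    have h1 : x t ⬝ᵥ Mᵀ *ᵥ (Q⁻¹ *ᵥ x t) = (M *ᵥ x t) ⬝ᵥ Q⁻¹ *ᵥ x t := by
      rw [dotProduct_mulVec, vecMul_transpose]
    have h2 : x t ⬝ᵥ Q⁻¹ *ᵥ (Q⁻¹ *ᵥ x t) = (Q⁻¹ *ᵥ x t) ⬝ᵥ Q⁻¹ *ᵥ x t := by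
      rw [dotProduct_mulVec, ← mulVec_transpose, hPsymm]
    simp only [star_trivial, sub_mulVec, add_mulVec, neg_mulVec, smul_mulVec, ← mulVec_mulVec,
      dotProduct_sub, dotProduct_add, dotProduct_neg, dotProduct_smul, smul_eq_mul, h1, h2] at h
    linarith
  refine ⟨fun t ht => (hV t ht).deriv.trans_le (hdecr t), ?_⟩
  obtain ⟨C, hC, hCle⟩ := Q.exists_pos_dotProduct_mulVec_le
  have hVle : ∀ t, x t ⬝ᵥ Q⁻¹ *ᵥ x t ≤ C * ((Q⁻¹ *ᵥ x t) ⬝ᵥ Q⁻¹ *ᵥ x t) := fun t => by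
    have h := hCle (Q⁻¹ *ᵥ x t)
    rwa [mulVec_mulVec _ Q, mul_nonsing_inv _ hdet, one_mulVec, dotProduct_comm _ (x t)] at h
  have hVlim : Tendsto (fun t => x t ⬝ᵥ Q⁻¹ *ᵥ x t) atTop (nhds 0) := by
    refine tendsto_zero_of_hasDerivAt_le_neg_mul (div_pos hκ1 hC) hV
      (fun t _ => (hdecr t).trans ?_)
      fun t => by simpa using hQ.inv.posSemidef.dotProduct_mulVec_nonneg (x t)
    have h := mul_le_mul_of_nonneg_left (hVle t) (div_pos hκ1 hC).le
    rw [← mul_assoc, div_mul_cancel₀ _ hC.ne'] at h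
    linarith
  refine tendsto_zero_of_dotProduct_self (squeeze_zero
    (fun t => Finset.sum_nonneg fun i _ => mul_self_nonneg (x t i))
    (fun t => hQ.dotProduct_self_le_mul_inv hC hCle (x t)) ?_)
  simpa using hVlim.const_mul C
end

section
/- Suppose κ1 > 0, κ2 ≥ 0, a symmetric positive definite Q ∈ ℝ^{m×m} and a row vector K ∈ ℝ^{1×m} satisfy the SDP (10). Set P = Q⁻¹. Then for EVERY pair (A, a) with A ∈ ℝ^{m×m} and a ∈ ℝ^m a column vector such that (O1+ − A·O1 − a·O2)·(O1+ − A·O1 − a·O2)ᵀ ⪯ γ·γᵀ, the matrix M = A + a·(K·P) satisfies P·M + Mᵀ·P ⪯ −κ1·P·P. -/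
open Matrix Filter

/-- Conjugating a block matrix by the row `[1, Θ]`. -/
theorem fromCols_one_mul_fromBlocks_mul_transpose {m n : Type*} [Fintype m] [Fintype n]
    [DecidableEq m] (X : Matrix m m ℝ) (Y : Matrix m n ℝ) (Z : Matrix n m ℝ) (V : Matrix n n ℝ)
    (Θ : Matrix m n ℝ) :
    fromCols (1 : Matrix m m ℝ) Θ * fromBlocks X Y Z V * (fromCols (1 : Matrix m m ℝ) Θ)ᵀ
      = X + Θ * Z + Y * Θᵀ + Θ * V * Θᵀ := by
  rw [fromCols_mul_fromBlocks, transpose_fromCols, fromCols_mul_fromRows]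
  simp only [Matrix.one_mul, transpose_one, Matrix.mul_one, Matrix.add_mul]
  abel

/-- Robust core of Theorem 1: if the SDP (10) is feasible, then for EVERY pair
`(A, a)` consistent with the noisy data (i.e. with residual energy bounded by
`γ γᵀ`), the closed-loop matrix `M = A + a (K P)` with `P = Q⁻¹` satisfies the
Lyapunov inequality `P M + Mᵀ P ⪯ -κ1 P P`. -/
theorem robust_sdp_all_consistent_systems (m T : ℕ) (hm : 1 ≤ m) (hT : 1 ≤ T)
    (O1 O1p γ : Matrix (Fin m) (Fin T) ℝ)
    (O2 : Matrix (Fin 1) (Fin T) ℝ)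
    (κ1 κ2 : ℝ) (hκ1 : 0 < κ1) (hκ2 : 0 ≤ κ2)
    (Q : Matrix (Fin m) (Fin m) ℝ) (hQsymm : Q.IsSymm) (hQ : Q.PosDef)
    (K : Matrix (Fin 1) (Fin m) ℝ)
    (hSDP :
      (-(Matrix.fromBlocks
          (κ1 • (1 : Matrix (Fin m) (Fin m) ℝ) - κ2 • (O1p * O1pᵀ - γ * γᵀ))
          ((Matrix.fromRows K Q)ᵀ + κ2 • (O1p * (Matrix.fromRows O2 O1)ᵀ))
          (Matrix.fromRows K Q + κ2 • (Matrix.fromRows O2 O1 * O1pᵀ))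
          (-(κ2 • (Matrix.fromRows O2 O1 * (Matrix.fromRows O2 O1)ᵀ))))).PosSemidef) :
    ∀ (A : Matrix (Fin m) (Fin m) ℝ) (a : Matrix (Fin m) (Fin 1) ℝ),
      (γ * γᵀ - (O1p - A * O1 - a * O2) * (O1p - A * O1 - a * O2)ᵀ).PosSemidef →
      ((-(κ1 • (Q⁻¹ * Q⁻¹)))
          - (Q⁻¹ * (A + a * (K * Q⁻¹)) + (A + a * (K * Q⁻¹))ᵀ * Q⁻¹)).PosSemidef := by
  intro A a hres
  set G := fromRows O2 O1
  set N := fromRows K Q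
  set Θ := fromCols a A
  have hΘG : Θ * G = a * O2 + A * O1 := fromCols_mul_fromRows ..
  have hΘN : Θ * N = a * K + A * Q := fromCols_mul_fromRows ..
  have hR : O1p - A * O1 - a * O2 = O1p - Θ * G := by rw [hΘG]; abel
  rw [hR] at hres
  have hconj := hSDP.mul_mul_conjTranspose_same (fromCols (1 : Matrix (Fin m) (Fin m) ℝ) Θ)
  rw [conjTranspose_eq_transpose_of_trivial, Matrix.mul_neg, Matrix.neg_mul,
    fromCols_one_mul_fromBlocks_mul_transpose] at hconj
  have hprimal : (-(κ1 • (1 : Matrix (Fin m) (Fin m) ℝ) + Θ * N + (Θ * N)ᵀ)).PosSemidef := by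
    convert hconj.add (hres.smul hκ2) using 1
    simp only [transpose_sub, transpose_mul, Matrix.sub_mul, Matrix.mul_sub, Matrix.mul_add,
      Matrix.add_mul, Matrix.mul_smul, Matrix.smul_mul, smul_sub, Matrix.mul_neg,
      Matrix.neg_mul, Matrix.mul_assoc]
    abel
  have hdet : IsUnit Q.det := (isUnit_iff_isUnit_det Q).mp hQ.isUnit
  have hPsymm : Q⁻¹ᵀ = Q⁻¹ := by rw [transpose_nonsing_inv, hQsymm.eq]
  have hM : Q⁻¹ * (A + a * (K * Q⁻¹)) = Q⁻¹ * (Θ * N) * Q⁻¹ := by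
    rw [hΘN]
    simp only [Matrix.mul_add, Matrix.add_mul, Matrix.mul_assoc, mul_nonsing_inv Q hdet,
      Matrix.mul_one]
    abel
  have hMt : (A + a * (K * Q⁻¹))ᵀ * Q⁻¹ = Q⁻¹ * (Θ * N)ᵀ * Q⁻¹ := by
    have h := congrArg transpose hM
    rwa [transpose_mul, transpose_mul (Q⁻¹ * (Θ * N)), transpose_mul Q⁻¹, hPsymm,
      ← Matrix.mul_assoc (Q⁻¹)] at h
  rw [hM, hMt]
  convert hprimal.mul_mul_conjTranspose_same Q⁻¹ using 1
  rw [conjTranspose_eq_transpose_of_trivial, hPsymm]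
  simp only [Matrix.mul_neg, Matrix.neg_mul, Matrix.mul_add, Matrix.add_mul, Matrix.mul_smul,
    Matrix.smul_mul, Matrix.mul_one]
  abel
end

section
/- Let m ≥ 1 and set n = m + 1. Let f : ℝⁿ → ℝ be continuously differentiable, let A ∈ ℝ^{m×m}, let a ∈ ℝ^m be a column vector, let b ∈ ℝ, let d : ℝ → ℝ be differentiable, let c ∈ ℝ^{1×m} be a row vector, and let ν : ℝ → ℝ. Suppose x_r : ℝ → ℝ^m and x_n, u : ℝ → ℝ are differentiable and satisfy, for all t: ẋ_r(t) = A·x_r(t) + a·x_n(t), ẋ_n(t) = f(x_r(t), x_n(t)) + b·u(t) + d(t), and u̇(t) = ν(t). Define σ(t) = x_n(t) − c·x_r(t). Then σ is twice differentiable, with σ̇(t) = f(x(t)) + b·u(t) + d(t) − c·(A·x_r(t) + a·x_n(t)) and σ̈(t) = Df(x(t))[ẋ(t)] + ḋ(t) − c·A·(A·x_r(t) + a·x_n(t)) − (c·a)·(f(x(t)) + b·u(t) + d(t)) + b·ν(t), where x(t) = (x_r(t), x_n(t)) ∈ ℝⁿ, ẋ(t) = (A x_r(t) + a x_n(t), f(x(t))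 + b u(t) + d(t)), and Df(x)[v] denotes the derivative of f at x applied to the direction v. -/
open Matrix

/-- The product rule for the dot product with a constant vector. -/
theorem HasDerivAt.const_dotProduct {ι : Type*} [Fintype ι] (c : ι → ℝ) {x : ℝ → ι → ℝ}
    {x' : ι → ℝ} {t : ℝ} (hx : HasDerivAt x x' t) :
    HasDerivAt (fun s => c ⬝ᵥ x s) (c ⬝ᵥ x') t :=
  HasDerivAt.fun_sum fun i _ => (hasDerivAt_pi.1 hx i).const_mul (c i)

/-- Auxiliary second-order sliding dynamics (21)–(23): for the strict-feedback
system `ẋ_r = A x_r + a x_n`, `ẋ_n = f(x) + b u + d`, with `u̇ = ν`, the sliding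
variable `σ = x_n - c x_r` is twice differentiable with
`σ̇ = f(x) + b u + d - c (A x_r + a x_n)` and
`σ̈ = Df(x)[ẋ] + ḋ - c A (A x_r + a x_n) - (c a)(f(x) + b u + d) + b ν`. -/
theorem sliding_variable_second_order (m : ℕ) (hm : 1 ≤ m)
    (f : ((Fin m → ℝ) × ℝ) → ℝ) (hf : ContDiff ℝ 1 f)
    (A : Matrix (Fin m) (Fin m) ℝ) (a : Fin m → ℝ) (b : ℝ)
    (d d' : ℝ → ℝ) (hd : ∀ t : ℝ, HasDerivAt d (d' t) t)
    (c : Fin m → ℝ) (ν : ℝ → ℝ)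
    (x_r : ℝ → Fin m → ℝ) (x_n u : ℝ → ℝ)
    (hxr : ∀ t : ℝ, HasDerivAt x_r (A.mulVec (x_r t) + x_n t • a) t)
    (hxn : ∀ t : ℝ, HasDerivAt x_n (f (x_r t, x_n t) + b * u t + d t) t)
    (hu : ∀ t : ℝ, HasDerivAt u (ν t) t) :
    (∀ t : ℝ, HasDerivAt (fun s => x_n s - c ⬝ᵥ x_r s)
        (f (x_r t, x_n t) + b * u t + d t
          - c ⬝ᵥ (A.mulVec (x_r t) + x_n t • a)) t) ∧
      ∀ t : ℝ, HasDerivAt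
        (fun s => f (x_r s, x_n s) + b * u s + d s
          - c ⬝ᵥ (A.mulVec (x_r s) + x_n s • a))
        (fderiv ℝ f (x_r t, x_n t)
            (A.mulVec (x_r t) + x_n t • a, f (x_r t, x_n t) + b * u t + d t)
          + d' t
          - (Matrix.vecMul c A) ⬝ᵥ (A.mulVec (x_r t) + x_n t • a)
          - (c ⬝ᵥ a) * (f (x_r t, x_n t) + b * u t + d t)
          + b * ν t) t := by
  refine ⟨fun t => (hxn t).sub ((hxr t).const_dotProduct c), fun t => ?_⟩
  have hfx : HasDerivAt (fun s => f (x_r s, x_n s)) _ t :=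
    (hf.differentiable one_ne_zero (x_r t, x_n t)).hasFDerivAt.comp_hasDerivAt t
      ((hxr t).prodMk (hxn t))
  have hlin : HasDerivAt (fun s => c ⬝ᵥ (A.mulVec (x_r s) + x_n s • a))
      (c ᵥ* A ⬝ᵥ (A.mulVec (x_r t) + x_n t • a)
        + (f (x_r t, x_n t) + b * u t + d t) * (c ⬝ᵥ a)) t := by
    simp only [dotProduct_add c, dotProduct_smul, dotProduct_mulVec c, smul_eq_mul]
    exact ((hxr t).const_dotProduct (c ᵥ* A)).add ((hxn t).mul_const (c ⬝ᵥ a))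
  refine (((hfx.add ((hu t).const_mul b)).add (hd t)).sub hlin).congr_deriv ?_
  ring
end
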